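/- Let (Λ,η) be a special isothermic surface in S³ of type d ∈ ℕ with respect to a polynomial conserved quantity p(t), which is not a special isothermic surface of type d−1. If the Christoffel transform (Λ^c,η^c) of (Λ,η) with respect to (v_∞,v_0) is a special isothermic surface of type d−1, then 0 is a repeated root of the polynomial (p(t),p(t)) and p(0) ∈ ⟨v_∞⟩. -/

import Mathlib

noncomputable section

open Finset

/-- Minkowski space `ℝ^{n+1,1}`, modelled on `Fin (n+2) → ℝ`. -/
abbrev MV (n : ℕ) : Type := EuclideanSpace ℝ (Fin (n + 2))

/-- The Minkowski inner product of signature `(n+1,1)`. -/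
def mink (n : ℕ) (x y : MV n) : ℝ :=
  ∑ i : Fin (n + 1), x i.castSucc * y i.castSucc
    - x (Fin.last (n + 1)) * y (Fin.last (n + 1))

/-- The light cone `L ⊂ ℝ^{n+1,1}`. -/
def LightCone (n : ℕ) : Set (MV n) := {v | v ≠ 0 ∧ mink n v v = 0}

/-- The skew endomorphism `u ∧ v`, acting by `(u ∧ v) w = (u,w)v − (v,w)u`. -/
def wedge (n : ℕ) (u v w : MV n) : MV n :=
  mink n u w • v - mink n v w • u

/-- The surface domain: a two-dimensional coordinate chart. -/
abbrev Surf : Type := ℝ × ℝ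

/-- the coordinate direction ∂/∂u -/
def du : Surf := (1, 0)

/-- the coordinate direction ∂/∂v -/
def dv : Surf := (0, 1)

/-- partial derivative of a section in a coordinate direction -/
def pd {n : ℕ} (e : Surf) (f : Surf → MV n) (x : Surf) : MV n :=
  fderiv ℝ f x e

lemma mink_add_left (n : ℕ) (a b c : MV n) :
    mink n (a + b) c = mink n a c + mink n b c := by
  simp [mink, PiLp.add_apply, add_mul, Finset.sum_add_distrib]; ring

lemma mink_smul_left (n : ℕ) (r : ℝ) (a c : MV n) :
    mink n (r • a) c = r * mink n a c := by
  simp [mink, PiLp.smul_apply, smul_eq_mul, mul_sub, Finset.mul_sum, mul_assoc]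

lemma mink_zero_left (n : ℕ) (c : MV n) : mink n 0 c = 0 := by
  simp [mink]

/-- An isothermic surface `(Λ,η)` in `S^n = P(L)`, given by a nowhere-zero null
lift `F` of the immersion `Λ` together with the 1-form
`η = F ∧ W₁ du + F ∧ W₂ dv` with values in `Λ ∧ Λ^⊥`. -/
structure IsothermicSurface (n : ℕ) : Type where
  F : Surf → MV n
  W₁ : Surf → MV n
  W₂ : Surf → MV n
  smooth_F : ContDiff ℝ (⊤ : ℕ∞) F
  smooth_W₁ : ContDiff ℝ (⊤ : ℕ∞) W₁
  smooth_W₂ : ContDiff ℝ (⊤ : ℕ∞) W₂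
  F_ne : ∀ x, F x ≠ 0
  F_null : ∀ x, mink n (F x) (F x) = 0
  immersed : ∀ x, LinearIndependent ℝ ![F x, pd du F x, pd dv F x]
  W₁_perp : ∀ x, mink n (F x) (W₁ x) = 0
  W₂_perp : ∀ x, mink n (F x) (W₂ x) = 0
  eta_ne : ∃ x z, wedge n (F x) (W₁ x) z ≠ 0 ∨ wedge n (F x) (W₂ x) z ≠ 0
  eta_closed : ∀ x z,
    fderiv ℝ (fun y => wedge n (F y) (W₂ y) z) x du
      = fderiv ℝ (fun y => wedge n (F y) (W₁ y) z) x dv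

/-- `s` is a parallel section for the flat connection `∇^t = d + tη`. -/
def ParallelSection (n : ℕ) (S : IsothermicSurface n) (t : ℝ)
    (s : Surf → MV n) : Prop :=
  ∀ x, fderiv ℝ s x du + t • wedge n (S.F x) (S.W₁ x) (s x) = 0
     ∧ fderiv ℝ s x dv + t • wedge n (S.F x) (S.W₂ x) (s x) = 0

/-- A polynomial conserved quantity of degree `d` of the isothermic surface
`(Λ,η)`: a polynomial `p(t) = Σ_{k=0}^d p_k t^k` of (smooth) sections, of exact
degree `d`, with `∇^t p(t) = 0` for all `t`. -/
structure PolyConservedQuantity (n : ℕ) (S : IsothermicSurface n) (d : ℕ) : Type where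
  coeff : ℕ → Surf → MV n
  smooth : ∀ k, ContDiff ℝ (⊤ : ℕ∞) (coeff k)
  coeff_eq_zero : ∀ k, d < k → coeff k = 0
  top_ne : coeff d ≠ 0
  conserved : ∀ t : ℝ, ParallelSection n S t
    (fun x => ∑ k ∈ Finset.range (d + 1), t ^ k • coeff k x)

/-- evaluation `p(t)` of a polynomial conserved quantity -/
def pcEval {n : ℕ} {S : IsothermicSurface n} {d : ℕ}
    (p : PolyConservedQuantity n S d) (t : ℝ) (x : Surf) : MV n :=
  ∑ k ∈ Finset.range (d + 1), t ^ k • p.coeff k x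

/-- `(Λ,η)` is a special isothermic surface of type `d`. -/
def SpecialOfType (n : ℕ) (S : IsothermicSurface n) (d : ℕ) : Prop :=
  Nonempty (PolyConservedQuantity n S d)

/-- `p₀ ∈ ⟨w⟩`: the polynomial conserved quantity exhibits `(Λ,η)` as special
isothermic in the space-form `E(w)`. -/
def InSpaceForm {n : ℕ} {S : IsothermicSurface n} {d : ℕ}
    (p : PolyConservedQuantity n S d) (w : MV n) : Prop :=
  ∃ c : ℝ, ∀ x, p.coeff 0 x = c • w

/-- fullness: the image of `Λ` lies in no proper subsphere -/
def Full (n : ℕ) (S : IsothermicSurface n) : Prop :=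
  ¬ ∃ p : MV n, p ≠ 0 ∧ ∀ x, mink n p (S.F x) = 0
/-- A Darboux transform `Λ̂` of `(Λ,η)` with parameter `m`, given by a
`∇^m`-parallel null lift `G` spanning an immersed surface with `Λ̂ ∩ Λ = 0`. -/
structure DarbouxTransform (n : ℕ) (S : IsothermicSurface n) (m : ℝ) : Type where
  G : Surf → MV n
  smooth_G : ContDiff ℝ (⊤ : ℕ∞) G
  G_ne : ∀ x, G x ≠ 0
  G_null : ∀ x, mink n (G x) (G x) = 0
  immersed : ∀ x, LinearIndependent ℝ ![G x, pd du G x, pd dv G x]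
  disjoint : ∀ x, G x ∉ Submodule.span ℝ {S.F x}
  parallel : ParallelSection n S m G

/-- The gauge transformation `Γ_{⟨F⟩}^{⟨G⟩}(c)`: acts as `c` on `⟨G⟩`, as `1` on
`(⟨F⟩ ⊕ ⟨G⟩)^⊥` and as `c⁻¹` on `⟨F⟩`. -/
def gaugeG (n : ℕ) (F G : MV n) (c : ℝ) (z : MV n) : MV n :=
  ((mink n G z / mink n F G) / c) • F
    + (c * (mink n F z / mink n F G)) • G
    + (z - (mink n G z / mink n F G) • F - (mink n F z / mink n F G) • G)

/-- `Γ_Λ^{Λ̂}(1 − t/m) · (d + tη) = d + tη̂` for all `t ≠ m`: the gauge relation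
between the pencils of flat connections of an isothermic surface `S` and of (an
isothermic structure `T` on) its Darboux transform with parameter `m`. -/
def GaugeRel (n : ℕ) (S T : IsothermicSurface n) (m : ℝ) : Prop :=
  ∀ t : ℝ, t ≠ m → ∀ s : Surf → MV n, ContDiff ℝ (⊤ : ℕ∞) s → ∀ x : Surf,
    (fderiv ℝ (fun y => gaugeG n (S.F y) (T.F y) (1 - t / m) (s y)) x du
        + t • wedge n (T.F x) (T.W₁ x) (gaugeG n (S.F x) (T.F x) (1 - t / m) (s x))
      = gaugeG n (S.F x) (T.F x) (1 - t / m)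
          (fderiv ℝ s x du + t • wedge n (S.F x) (S.W₁ x) (s x)))
    ∧ (fderiv ℝ (fun y => gaugeG n (S.F y) (T.F y) (1 - t / m) (s y)) x dv
        + t • wedge n (T.F x) (T.W₂ x) (gaugeG n (S.F x) (T.F x) (1 - t / m) (s x))
      = gaugeG n (S.F x) (T.F x) (1 - t / m)
          (fderiv ℝ s x dv + t • wedge n (S.F x) (S.W₂ x) (s x)))

/-- `Λ̂ = ⟨p(m)⟩` with `(p(m),p(m)) = 0`: the Darboux transform `D` is a
complementary surface of `(Λ,η)` with respect to `p(t)`. -/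
def IsComplementary (n : ℕ) {S : IsothermicSurface n} {d : ℕ}
    (p : PolyConservedQuantity n S d) {m : ℝ} (D : DarbouxTransform n S m) : Prop :=
  (∀ x, mink n (pcEval p m x) (pcEval p m x) = 0) ∧
  (∀ x, Submodule.span ℝ {D.G x} = Submodule.span ℝ {pcEval p m x})

/-- `m` is a repeated root of the (constant-coefficient) polynomial `(p(t),p(t))`. -/
def IsRepeatedRootAt {n : ℕ} {S : IsothermicSurface n} {d : ℕ}
    (p : PolyConservedQuantity n S d) (m : ℝ) : Prop :=
  ∀ x, mink n (pcEval p m x) (pcEval p m x) = 0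
    ∧ deriv (fun t : ℝ => mink n (pcEval p t x) (pcEval p t x)) m = 0
/-- metric coefficient `g₁₁ = (F_u,F_u)` of the induced metric -/
def gUU (n : ℕ) (F : Surf → MV n) (x : Surf) : ℝ := mink n (pd du F x) (pd du F x)

/-- metric coefficient `g₁₂ = (F_u,F_v)` -/
def gUV (n : ℕ) (F : Surf → MV n) (x : Surf) : ℝ := mink n (pd du F x) (pd dv F x)

/-- metric coefficient `g₂₂ = (F_v,F_v)` -/
def gVV (n : ℕ) (F : Surf → MV n) (x : Surf) : ℝ := mink n (pd dv F x) (pd dv F x)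

/-- `(𝐇, N)`, the inner product of the mean curvature vector of `F` (in a
space-form `E(w)`) with a normal field `N`: half the trace with respect to the
induced metric of the `N`-component of the second fundamental form. -/
def meanCurv (n : ℕ) (F N : Surf → MV n) (x : Surf) : ℝ :=
  (gVV n F x * mink n (pd du (pd du F) x) (N x)
    - 2 * gUV n F x * mink n (pd du (pd dv F) x) (N x)
    + gUU n F x * mink n (pd dv (pd dv F) x) (N x))
  / (2 * (gUU n F x * gVV n F x - gUV n F x ^ 2))

/-- `N` is a unit normal field of the lift `F : Σ → E(w)`. -/
def IsUnitNormal (n : ℕ) (F N : Surf → MV n) (w : MV n) : Prop :=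
  (∀ x, mink n (N x) (N x) = 1) ∧ (∀ x, mink n (N x) w = 0)
    ∧ (∀ x, mink n (N x) (F x) = 0)
    ∧ (∀ x, mink n (N x) (pd du F x) = 0) ∧ (∀ x, mink n (N x) (pd dv F x) = 0)

/-- `N` is parallel for the normal connection of `F : Σ → E(w)`: the derivative
of `N` has no component in the normal bundle of `F` in `E(w)`. -/
def ParallelNormal (n : ℕ) (F N : Surf → MV n) (w : MV n) : Prop :=
  ∀ x e, fderiv ℝ N x e ∈ Submodule.span ℝ {F x, pd du F x, pd dv F x, w}

/-- the chart coordinates `(u,v)` are conformal curvature line coordinates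
corresponding to `η`, with conformal factor `e^{2θ}`:
`I = e^{2θ}(du² + dv²)` and `η = e^{−2θ} F ∧ (−F_u du + F_v dv)`. -/
def ConformalCoords (n : ℕ) (S : IsothermicSurface n) (θ : Surf → ℝ) : Prop :=
  ContDiff ℝ (⊤ : ℕ∞) θ
  ∧ (∀ x, mink n (pd du S.F x) (pd du S.F x) = Real.exp (2 * θ x))
  ∧ (∀ x, mink n (pd dv S.F x) (pd dv S.F x) = Real.exp (2 * θ x))
  ∧ (∀ x, mink n (pd du S.F x) (pd dv S.F x) = 0)
  ∧ (∀ x z, wedge n (S.F x) (S.W₁ x) z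
      = Real.exp (-(2 * θ x)) • wedge n (S.F x) (-pd du S.F x) z)
  ∧ (∀ x z, wedge n (S.F x) (S.W₂ x) z
      = Real.exp (-(2 * θ x)) • wedge n (S.F x) (pd dv S.F x) z)

/-- the second fundamental form of the lift `F` in `E(w)` with respect to the
unit normal `N` is `II = e^{2θ}(k₁ du² + k₂ dv²)`. -/
def PrincipalCurvatures (n : ℕ) (S : IsothermicSurface n) (N : Surf → MV n)
    (θ k₁ k₂ : Surf → ℝ) : Prop :=
  (∀ x, mink n (pd du (pd du S.F) x) (N x) = Real.exp (2 * θ x) * k₁ x)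
  ∧ (∀ x, mink n (pd du (pd dv S.F) x) (N x) = 0)
  ∧ (∀ x, mink n (pd dv (pd dv S.F) x) (N x) = Real.exp (2 * θ x) * k₂ x)

/-- partial derivative of a real function on the surface -/
def pdR (e : Surf) (f : Surf → ℝ) (x : Surf) : ℝ := fderiv ℝ f x e
/-- `(Λ^c, η^c)` is the Christoffel transform of `(Λ,η)` with respect to the
pair `(v∞, v₀)`, witnessed by the stereoprojections `f`, `f^c` into
`ℝ^n = ⟨v₀,v∞⟩^⊥`:  `F = exp(f ∧ v∞)v₀`, `F^c = exp(f^c ∧ v₀)v∞`,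
`η = Ad(exp(f ∧ v∞))(df^c ∧ v₀)` and `η^c = Ad(exp(f^c ∧ v₀))(df ∧ v∞)`. -/
def IsChristoffelPair (n : ℕ) (S Sc : IsothermicSurface n) (vinf v0 : MV n)
    (f fc : Surf → MV n) : Prop :=
  vinf ∈ LightCone n ∧ v0 ∈ LightCone n ∧ mink n v0 vinf = -1
  ∧ ContDiff ℝ (⊤ : ℕ∞) f ∧ ContDiff ℝ (⊤ : ℕ∞) fc
  ∧ (∀ x, mink n (f x) v0 = 0) ∧ (∀ x, mink n (f x) vinf = 0)
  ∧ (∀ x, mink n (fc x) v0 = 0) ∧ (∀ x, mink n (fc x) vinf = 0)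
  ∧ (∀ x, S.F x = v0 + f x + (mink n (f x) (f x) / 2) • vinf)
  ∧ (∀ x, Sc.F x = vinf + fc x + (mink n (fc x) (fc x) / 2) • v0)
  ∧ (∀ x z, wedge n (S.F x) (S.W₁ x) z
      = wedge n (pd du fc x + mink n (f x) (pd du fc x) • vinf) (S.F x) z)
  ∧ (∀ x z, wedge n (S.F x) (S.W₂ x) z
      = wedge n (pd dv fc x + mink n (f x) (pd dv fc x) • vinf) (S.F x) z)
  ∧ (∀ x z, wedge n (Sc.F x) (Sc.W₁ x) z
      = wedge n (pd du f x + mink n (fc x) (pd du f x) • v0) (Sc.F x) z)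
  ∧ (∀ x z, wedge n (Sc.F x) (Sc.W₂ x) z
      = wedge n (pd dv f x + mink n (fc x) (pd dv f x) • v0) (Sc.F x) z)

/-- `Φ` is an orthogonal gauge transformation with `Φ · (d + sη) = d`. -/
def IsTGauge (n : ℕ) (S : IsothermicSurface n) (s : ℝ)
    (Φ : Surf → MV n → MV n) : Prop :=
  (∀ x, IsLinearMap ℝ (Φ x))
  ∧ (∀ x z z', mink n (Φ x z) (Φ x z') = mink n z z')
  ∧ (∀ σ : Surf → MV n, ContDiff ℝ (⊤ : ℕ∞) σ → ∀ x,
      (fderiv ℝ (fun y => Φ y (σ y)) x du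
         = Φ x (fderiv ℝ σ x du + s • wedge n (S.F x) (S.W₁ x) (σ x)))
      ∧ (fderiv ℝ (fun y => Φ y (σ y)) x dv
         = Φ x (fderiv ℝ σ x dv + s • wedge n (S.F x) (S.W₂ x) (σ x))))

/-- `(Λ_s, η_s)` is the T-transform of `(Λ,η)` associated to `Φ_s`:
`Λ_s = Φ_s Λ` and `η_s = Ad(Φ_s) η`. -/
def IsTTransform (n : ℕ) (S : IsothermicSurface n) (s : ℝ)
    (Φ : Surf → MV n → MV n) (Ss : IsothermicSurface n) : Prop :=
  IsTGauge n S s Φ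
  ∧ (∀ x, Ss.F x = Φ x (S.F x))
  ∧ (∀ x z, wedge n (Ss.F x) (Ss.W₁ x) (Φ x z) = Φ x (wedge n (S.F x) (S.W₁ x) z))
  ∧ (∀ x z, wedge n (Ss.F x) (Ss.W₂ x) (Φ x z) = Φ x (wedge n (S.F x) (S.W₂ x) z))

/-- orthogonal complement with respect to the Minkowski form -/
def mperp (n : ℕ) (U : Submodule ℝ (MV n)) : Submodule ℝ (MV n) where
  carrier := {v | ∀ u ∈ U, mink n v u = 0}
  add_mem' := by
    intro a b ha hb u hu
    rw [mink_add_left, ha u hu, hb u hu, add_zero]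
  zero_mem' := by
    intro u hu; exact mink_zero_left n u
  smul_mem' := by
    intro r a ha u hu
    rw [mink_smul_left, ha u hu, mul_zero]

/-- the spherical system of `Λ` and a Darboux transform `Λ̂ = ⟨G⟩`: the
`(n−2)`-sphere congruence `C = Λ ⊕ Λ̂ ⊕ V_R^⊥`, `V_R = Λ^{(1)} ⊕ Λ̂`. -/
def sphericalSystem (n : ℕ) (S : IsothermicSurface n) (G : Surf → MV n)
    (x : Surf) : Submodule ℝ (MV n) :=
  Submodule.span ℝ {S.F x, G x}
    ⊔ mperp n (Submodule.span ℝ {S.F x, pd du S.F x, pd dv S.F x, G x})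

/-- the sphere-planes congruence `P = C + ⟨w⟩` of `Λ` and `Λ̂ = ⟨G⟩` with
respect to `w`. -/
def spherePlanes (n : ℕ) (S : IsothermicSurface n) (G : Surf → MV n)
    (w : MV n) (x : Surf) : Submodule ℝ (MV n) :=
  sphericalSystem n S G x ⊔ Submodule.span ℝ {w}

section MinkowskiAlgebra

variable {n : ℕ}

lemma mink_comm (x y : MV n) : mink n x y = mink n y x := by
  simp [mink, mul_comm]

lemma mink_add_right (a b c : MV n) : mink n a (b + c) = mink n a b + mink n a c := by
  rw [mink_comm, mink_add_left, mink_comm b, mink_comm c]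

lemma mink_smul_right (r : ℝ) (a b : MV n) : mink n a (r • b) = r * mink n a b := by
  rw [mink_comm, mink_smul_left, mink_comm]

lemma mink_zero_right (a : MV n) : mink n a 0 = 0 := by
  rw [mink_comm, mink_zero_left]

lemma mink_neg_left (a b : MV n) : mink n (-a) b = -mink n a b := by
  rw [← neg_one_smul ℝ a, mink_smul_left]; ring

lemma mink_neg_right (a b : MV n) : mink n a (-b) = -mink n a b := by
  rw [mink_comm, mink_neg_left, mink_comm]

lemma mink_sub_left (a b c : MV n) : mink n (a - b) c = mink n a c - mink n b c := by
  rw [sub_eq_add_neg, mink_add_left, mink_neg_left]; ring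

lemma mink_sub_right (a b c : MV n) : mink n a (b - c) = mink n a b - mink n a c := by
  rw [sub_eq_add_neg, mink_add_right, mink_neg_right]; ring

/-- The Minkowski form is positive definite on the orthogonal complement of a timelike vector. -/
lemma mink_self_pos_of_perp_timelike {y T : MV n} (hT : mink n T T < 0) (hyT : mink n y T = 0)
    (hy : y ≠ 0) : 0 < mink n y y := by
  by_contra! hle
  simp only [mink] at hT hyT hle
  have hcs := Finset.sum_mul_sq_le_sq_mul_sq Finset.univ
    (fun i : Fin (n + 1) => y i.castSucc) (fun i : Fin (n + 1) => T i.castSucc)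
  simp only [← pow_two] at hT hle
  set a := ∑ i : Fin (n + 1), y i.castSucc ^ 2 with ha
  set b := ∑ i : Fin (n + 1), T i.castSucc ^ 2 with hb
  set c := y (Fin.last (n + 1))
  set e := T (Fin.last (n + 1))
  have hyT' : ∑ i : Fin (n + 1), y i.castSucc * T i.castSucc = c * e := by linarith
  rw [hyT'] at hcs
  have hb0 : 0 ≤ b := Finset.sum_nonneg fun i _ => sq_nonneg _
  have ha0 : 0 ≤ a := Finset.sum_nonneg fun i _ => sq_nonneg _
  have hc : c = 0 := by
    by_contra hc
    have : 0 < c ^ 2 := by positivity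
    nlinarith
  have ha' : a = 0 := le_antisymm (by rw [hc] at hle; linarith) ha0
  rw [ha, Finset.sum_eq_zero_iff_of_nonneg fun i _ => sq_nonneg _] at ha'
  apply hy
  ext i
  refine Fin.lastCases hc (fun j => ?_) i
  simpa using ha' j (Finset.mem_univ j)

/-- A null vector orthogonal to a null vector `F` is a multiple of `F`. -/
lemma eq_smul_of_null_of_perp_null {F w z : MV n} (hF : mink n F F = 0) (hw : mink n w w = 0)
    (hFw : mink n F w = -1) (hzF : mink n z F = 0) (hz : mink n z z = 0) :
    z = (-mink n z w) • F := by
  by_contra hne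
  have hwF : mink n w F = -1 := by rw [mink_comm, hFw]
  have hFz : mink n F z = 0 := by rw [mink_comm, hzF]
  have hy : z + mink n z w • F ≠ 0 := by
    intro h
    apply hne
    linear_combination (norm := module) h
  have := mink_self_pos_of_perp_timelike (y := z + mink n z w • F) (T := F + w)
    (by simp only [mink_add_left, mink_add_right, hF, hw, hFw, hwF]; norm_num)
    (by simp only [mink_add_left, mink_add_right, mink_smul_left, hF, hFw, hzF]; ring) hy
  simp only [mink_add_left, mink_add_right, mink_smul_left, mink_smul_right, hF, hzF, hFz, hz]
    at this
  norm_num at this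

lemma wedge_add_right (u v a b : MV n) :
    wedge n u v (a + b) = wedge n u v a + wedge n u v b := by
  simp only [wedge, mink_add_right]; module

lemma wedge_smul_right (u v : MV n) (r : ℝ) (a : MV n) :
    wedge n u v (r • a) = r • wedge n u v a := by
  simp only [wedge, mink_smul_right]; module

lemma wedge_zero_right (u v : MV n) : wedge n u v 0 = 0 := by
  simp [wedge, mink_zero_right]

lemma wedge_sum_right {ι : Type*} (s : Finset ι) (u v : MV n) (a : ι → MV n) :
    wedge n u v (∑ i ∈ s, a i) = ∑ i ∈ s, wedge n u v (a i) := by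
  classical
  induction s using Finset.induction_on with
  | empty => simp [wedge_zero_right]
  | insert i s hi ih => rw [Finset.sum_insert hi, Finset.sum_insert hi, wedge_add_right, ih]

end MinkowskiAlgebra

section Calculus

variable {n : ℕ}

lemma HasDerivAt.mink {a b : ℝ → MV n} {a' b' : MV n} {t : ℝ} (ha : HasDerivAt a a' t)
    (hb : HasDerivAt b b' t) :
    HasDerivAt (fun s => mink n (a s) (b s)) (mink n a' (b t) + mink n (a t) b') t := by
  have hc : ∀ (i : Fin (n + 2)) {c : ℝ → MV n} {c' : MV n}, HasDerivAt c c' t →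
      HasDerivAt (fun s => c s i) (c' i) t := fun i c c' h =>
    (EuclideanSpace.proj (𝕜 := ℝ) i).hasFDerivAt.comp_hasDerivAt t h
  have h := (HasDerivAt.fun_sum (u := Finset.univ) fun (i : Fin (n + 1)) _ =>
    (hc i.castSucc ha).mul (hc i.castSucc hb)).sub
      ((hc (Fin.last (n + 1)) ha).mul (hc (Fin.last (n + 1)) hb))
  refine h.congr_deriv ?_
  simp only [_root_.mink, Finset.sum_add_distrib]
  ring

lemma ContDiff.mink {a b : Surf → MV n} (ha : ContDiff ℝ (⊤ : ℕ∞) a)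
    (hb : ContDiff ℝ (⊤ : ℕ∞) b) : ContDiff ℝ (⊤ : ℕ∞) (fun x => mink n (a x) (b x)) := by
  have hc : ∀ (i : Fin (n + 2)) {c : Surf → MV n}, ContDiff ℝ (⊤ : ℕ∞) c →
      ContDiff ℝ (⊤ : ℕ∞) (fun x => c x i) := fun i c h =>
    (EuclideanSpace.proj (𝕜 := ℝ) i).contDiff.comp h
  exact (ContDiff.sum fun (i : Fin (n + 1)) _ => (hc i.castSucc ha).mul (hc i.castSucc hb)).sub
    ((hc _ ha).mul (hc _ hb))

lemma hasLineDerivAt_of_contDiff {E : Type*} [NormedAddCommGroup E] [NormedSpace ℝ E]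
    {a : Surf → E} (ha : ContDiff ℝ (⊤ : ℕ∞) a) (x e : Surf) :
    HasDerivAt (fun t : ℝ => a (x + t • e)) (fderiv ℝ a x e) 0 :=
  ((ha.differentiable (by simp) x).hasFDerivAt.hasLineDerivAt e)

lemma pd_eq_of_hasDerivAt {a : Surf → MV n} (ha : ContDiff ℝ (⊤ : ℕ∞) a) {x e : Surf} {v : MV n}
    (h : HasDerivAt (fun t : ℝ => a (x + t • e)) v 0) : pd e a x = v :=
  (hasLineDerivAt_of_contDiff ha x e).unique h

/-- Product rule for the Minkowski form. -/
lemma fderiv_mink {a b : Surf → MV n} (ha : ContDiff ℝ (⊤ : ℕ∞) a) (hb : ContDiff ℝ (⊤ : ℕ∞) b)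
    (x e : Surf) :
    fderiv ℝ (fun y => mink n (a y) (b y)) x e
      = mink n (pd e a x) (b x) + mink n (a x) (pd e b x) := by
  have h := (hasLineDerivAt_of_contDiff ha x e).mink (hasLineDerivAt_of_contDiff hb x e)
  rw [zero_smul, add_zero] at h
  exact (hasLineDerivAt_of_contDiff (ha.mink hb) x e).unique h

lemma fderiv_eq_zero_of_du_dv {E : Type*} [NormedAddCommGroup E] [NormedSpace ℝ E]
    {a : Surf → E} {x : Surf} (hu : fderiv ℝ a x du = 0) (hv : fderiv ℝ a x dv = 0) :
    fderiv ℝ a x = 0 := by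
  ext <;> simpa using by assumption

lemma eq_of_pd_eq_zero {a : Surf → ℝ} (ha : ContDiff ℝ (⊤ : ℕ∞) a)
    (hu : ∀ x, fderiv ℝ a x du = 0) (hv : ∀ x, fderiv ℝ a x dv = 0) (x y : Surf) : a x = a y :=
  is_const_of_fderiv_eq_zero (ha.differentiable (by simp))
    (fun z => fderiv_eq_zero_of_du_dv (hu z) (hv z)) x y

lemma coeff_eq_zero_of_sum_pow_smul_eq_zero {N : ℕ} {c : ℕ → MV n}
    (h : ∀ t : ℝ, ∑ k ∈ Finset.range N, t ^ k • c k = 0) {k : ℕ} (hk : k < N) : c k = 0 := by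
  ext i
  have hP : (∑ j ∈ Finset.range N, Polynomial.monomial j (c j i) : Polynomial ℝ) = 0 := by
    refine Polynomial.funext fun t => ?_
    have := congrArg (fun v : MV n => v i) (h t)
    simpa [Polynomial.eval_finsetSum, mul_comm] using this
  have := congrArg (fun P : Polynomial ℝ => P.coeff k) hP
  simpa [Polynomial.finsetSum_coeff, Polynomial.coeff_monomial, hk] using this

end Calculus

section ConservedSequences

variable {n : ℕ}

/-- Multiplication by `t` on the coefficients of a polynomial of sections. -/
def shiftSeq (a : ℕ → Surf → MV n) : ℕ → Surf → MV n
  | 0 => 0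
  | k + 1 => a k

/-- The sections `a k` are the coefficients of a formal power series in `t` that is
parallel for the pencil `d + tη`. -/
structure IsConservedSeq (S : IsothermicSurface n) (a : ℕ → Surf → MV n) : Prop where
  smooth : ∀ k, ContDiff ℝ (⊤ : ℕ∞) (a k)
  pd_du : ∀ k x, pd du (a k) x + wedge n (S.F x) (S.W₁ x) (shiftSeq a k x) = 0
  pd_dv : ∀ k x, pd dv (a k) x + wedge n (S.F x) (S.W₂ x) (shiftSeq a k x) = 0

lemma pd_sum_pow_smul {a : ℕ → Surf → MV n} (ha : ∀ k, ContDiff ℝ (⊤ : ℕ∞) (a k)) (N : ℕ)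
    (t : ℝ) (x e : Surf) :
    fderiv ℝ (fun y => ∑ k ∈ Finset.range N, t ^ k • a k y) x e
      = ∑ k ∈ Finset.range N, t ^ k • pd e (a k) x := by
  have h : HasFDerivAt (fun y => ∑ k ∈ Finset.range N, t ^ k • a k y)
      (∑ k ∈ Finset.range N, t ^ k • fderiv ℝ (a k) x) x :=
    HasFDerivAt.fun_sum fun k _ =>
      (((ha k).differentiable (by simp) x).hasFDerivAt).const_smul (t ^ k)
  rw [h.fderiv]
  simp [pd]

lemma parallel_sum_eq {a : ℕ → Surf → MV n} (ha : ∀ k, ContDiff ℝ (⊤ : ℕ∞) (a k)) {d : ℕ}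
    (hd : ∀ k, d < k → a k = 0) (t : ℝ) (x e : Surf) (u w : MV n) :
    fderiv ℝ (fun y => ∑ k ∈ Finset.range (d + 1), t ^ k • a k y) x e
        + t • wedge n u w (∑ k ∈ Finset.range (d + 1), t ^ k • a k x)
      = ∑ k ∈ Finset.range (d + 2), t ^ k • (pd e (a k) x + wedge n u w (shiftSeq a k x)) := by
  have h0 : pd e (a (d + 1)) x = 0 := by
    rw [hd (d + 1) (by omega)]; simp [pd]
  simp only [smul_add, Finset.sum_add_distrib]
  rw [pd_sum_pow_smul ha, Finset.sum_range_succ (fun k => t ^ k • pd e (a k) x) (d + 1), h0,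
    smul_zero, add_zero, Finset.sum_range_succ' _ (d + 1)]
  simp only [shiftSeq, Pi.zero_apply, wedge_zero_right, smul_zero, add_zero, wedge_sum_right,
    wedge_smul_right, Finset.smul_sum, smul_smul, pow_succ']

lemma PolyConservedQuantity.isConservedSeq {S : IsothermicSurface n} {d : ℕ}
    (p : PolyConservedQuantity n S d) : IsConservedSeq S p.coeff := by
  have key : ∀ (e x : Surf) (w : MV n),
      (∀ t : ℝ, fderiv ℝ (fun y => ∑ k ∈ Finset.range (d + 1), t ^ k • p.coeff k y) x e
        + t • wedge n (S.F x) w (∑ k ∈ Finset.range (d + 1), t ^ k • p.coeff k x) = 0) →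
      ∀ k, pd e (p.coeff k) x + wedge n (S.F x) w (shiftSeq p.coeff k x) = 0 := by
    intro e x w h k
    rcases lt_or_ge k (d + 2) with hk | hk
    · refine coeff_eq_zero_of_sum_pow_smul_eq_zero (N := d + 2)
        (c := fun k => pd e (p.coeff k) x + wedge n (S.F x) w (shiftSeq p.coeff k x))
        (fun t => ?_) hk
      rw [← parallel_sum_eq p.smooth p.coeff_eq_zero, h t]
    · obtain ⟨j, rfl⟩ : ∃ j, k = j + 1 := ⟨k - 1, by omega⟩
      rw [p.coeff_eq_zero (j + 1) (by omega)]
      simp [shiftSeq, p.coeff_eq_zero j (by omega), wedge_zero_right, pd]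
  exact ⟨p.smooth, fun k x => key du x _ (fun t => (p.conserved t x).1) k,
    fun k x => key dv x _ (fun t => (p.conserved t x).2) k⟩

namespace IsConservedSeq

variable {S : IsothermicSurface n} {a b : ℕ → Surf → MV n}

lemma specialOfType (ha : IsConservedSeq S a) {d : ℕ} (hd : ∀ k, d < k → a k = 0)
    (htop : a d ≠ 0) : SpecialOfType n S d := by
  refine ⟨⟨a, ha.smooth, hd, htop, fun t x => ⟨?_, ?_⟩⟩⟩
  · rw [parallel_sum_eq ha.smooth hd]
    exact Finset.sum_eq_zero fun k _ => by rw [ha.pd_du k x, smul_zero]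
  · rw [parallel_sum_eq ha.smooth hd]
    exact Finset.sum_eq_zero fun k _ => by rw [ha.pd_dv k x, smul_zero]

lemma shift (ha : IsConservedSeq S a) : IsConservedSeq S (shiftSeq a) := by
  refine ⟨fun k => ?_, fun k x => ?_, fun k x => ?_⟩
  · cases k with
    | zero => exact contDiff_const
    | succ k => exact ha.smooth k
  · cases k with
    | zero => simp [shiftSeq, pd, wedge_zero_right]
    | succ k => exact ha.pd_du k x
  · cases k with
    | zero => simp [shiftSeq, pd, wedge_zero_right]
    | succ k => exact ha.pd_dv k x

lemma sub_smul (ha : IsConservedSeq S a) (hb : IsConservedSeq S b) (c : ℝ) :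
    IsConservedSeq S (fun k x => b k x - c • a k x) := by
  have hs : ∀ k x, shiftSeq (fun k x => b k x - c • a k x) k x
      = shiftSeq b k x + (-c) • shiftSeq a k x := by
    intro k x
    cases k with
    | zero => simp [shiftSeq]
    | succ k => simp [shiftSeq, sub_eq_add_neg]
  have hsm : ∀ k, ContDiff ℝ (⊤ : ℕ∞) (fun x => b k x - c • a k x) := fun k =>
    (hb.smooth k).sub ((ha.smooth k).const_smul c)
  have hpd : ∀ k x e, pd e (fun x => b k x - c • a k x) x = pd e (b k) x - c • pd e (a k) x :=
    fun k x e => pd_eq_of_hasDerivAt (hsm k) ((hasLineDerivAt_of_contDiff (hb.smooth k) x e).sub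
      ((hasLineDerivAt_of_contDiff (ha.smooth k) x e).const_smul c))
  refine ⟨hsm, fun k x => ?_, fun k x => ?_⟩
  · rw [hpd, hs, wedge_add_right, wedge_smul_right]
    linear_combination (norm := module) hb.pd_du k x - c • ha.pd_du k x
  · rw [hpd, hs, wedge_add_right, wedge_smul_right]
    linear_combination (norm := module) hb.pd_dv k x - c • ha.pd_dv k x

lemma specialOfType_add (ha : IsConservedSeq S a) {d : ℕ} (hd : ∀ k, d < k → a k = 0)
    (htop : a d ≠ 0) (j : ℕ) : SpecialOfType n S (d + j) := by
  induction j generalizing a d with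
  | zero => exact ha.specialOfType hd htop
  | succ j ih =>
    have hs : ∀ k, d + 1 < k → shiftSeq a k = 0 := by
      rintro (_ | k) hk
      · rfl
      · exact hd k (by omega)
    have := ih ha.shift hs htop
    rwa [add_right_comm] at this

/-- A surface that is not special isothermic of type `d` has no nonzero conserved quantities
of degree at most `d`. -/
lemma eq_zero_of_not_specialOfType {d : ℕ} (hS : ¬ SpecialOfType n S d)
    (ha : IsConservedSeq S a) (hd : ∀ k, d < k → a k = 0) : a = 0 := by
  classical
  by_contra h
  obtain ⟨k, hk⟩ := Function.ne_iff.mp h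
  have hkd : k ≤ d := by
    by_contra! hlt
    exact hk (hd k hlt)
  have hm : a (Nat.findGreatest (fun k => a k ≠ 0) d) ≠ 0 :=
    Nat.findGreatest_spec (P := fun k => a k ≠ 0) hkd hk
  have hle := Nat.findGreatest_le (P := fun k => a k ≠ 0) d
  set m := Nat.findGreatest (fun k => a k ≠ 0) d with hmdef
  refine hS ?_
  have := ha.specialOfType_add (d := m) (fun j hj => ?_) hm (d - m)
  · rwa [Nat.add_sub_cancel' hle] at this
  · rcases le_or_gt j d with hjd | hjd
    · exact not_not.mp (Nat.findGreatest_is_greatest (hmdef ▸ hj) hjd)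
    · exact hd j hjd

end IsConservedSeq

end ConservedSequences

section TopCoefficient

variable {n : ℕ} {S : IsothermicSurface n} {a a' : Surf → MV n}

/-- `a` is a section annihilated by `η` with `da = -η a'`, such as the leading coefficient of
a polynomial conserved quantity. -/
structure IsTopPair (S : IsothermicSurface n) (a a' : Surf → MV n) : Prop where
  smooth : ContDiff ℝ (⊤ : ℕ∞) a
  pd_du : ∀ x, pd du a x + wedge n (S.F x) (S.W₁ x) (a' x) = 0
  pd_dv : ∀ x, pd dv a x + wedge n (S.F x) (S.W₂ x) (a' x) = 0
  wedge_du : ∀ x, wedge n (S.F x) (S.W₁ x) (a x) = 0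
  wedge_dv : ∀ x, wedge n (S.F x) (S.W₂ x) (a x) = 0

lemma IsConservedSeq.isTopPair {a : ℕ → Surf → MV n} (ha : IsConservedSeq S a) {k : ℕ}
    (hk : a (k + 1) = 0) : IsTopPair S (a k) (shiftSeq a k) := by
  refine ⟨ha.smooth k, ha.pd_du k, ha.pd_dv k, fun x => ?_, fun x => ?_⟩
  · simpa [hk, pd, shiftSeq] using ha.pd_du (k + 1) x
  · simpa [hk, pd, shiftSeq] using ha.pd_dv (k + 1) x

lemma mink_F_pd_F (S : IsothermicSurface n) (x e : Surf) : mink n (S.F x) (pd e S.F x) = 0 := by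
  have h := fderiv_mink S.smooth_F S.smooth_F x e
  simp only [S.F_null] at h
  rw [mink_comm (pd e S.F x)] at h
  simp at h
  linarith

namespace IsTopPair

lemma mink_F (ha : IsTopPair S a a') {x : Surf} (hη : ∃ z, wedge n (S.F x) (S.W₁ x) z ≠ 0) :
    mink n (S.F x) (a x) = 0 := by
  obtain ⟨z, hz⟩ := hη
  by_contra h
  have h1 := ha.wedge_du x
  rw [wedge, sub_eq_zero] at h1
  have hW : S.W₁ x = ((mink n (S.F x) (a x))⁻¹ * mink n (S.W₁ x) (a x)) • S.F x := by
    rw [mul_smul, ← h1, smul_smul, inv_mul_cancel₀ h, one_smul]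
  apply hz
  rw [hW, wedge, mink_smul_left]
  module

lemma mink_W₁ (ha : IsTopPair S a a') {x : Surf} (hη : ∃ z, wedge n (S.F x) (S.W₁ x) z ≠ 0) :
    mink n (S.W₁ x) (a x) = 0 := by
  have h := ha.wedge_du x
  rw [wedge, ha.mink_F hη, zero_smul, zero_sub, neg_eq_zero] at h
  exact (smul_eq_zero.mp h).resolve_right (S.F_ne x)

lemma mink_W₂ (ha : IsTopPair S a a') {x : Surf} (hη : ∃ z, wedge n (S.F x) (S.W₁ x) z ≠ 0) :
    mink n (S.W₂ x) (a x) = 0 := by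
  have h := ha.wedge_dv x
  rw [wedge, ha.mink_F hη, zero_smul, zero_sub, neg_eq_zero] at h
  exact (smul_eq_zero.mp h).resolve_right (S.F_ne x)

lemma mink_pd_du (ha : IsTopPair S a a')
    (hη : ∀ x, ∃ z, wedge n (S.F x) (S.W₁ x) z ≠ 0) (x : Surf) :
    mink n (pd du S.F x) (a x) = 0 := by
  have h := fderiv_mink S.smooth_F ha.smooth x du
  simp only [ha.mink_F (hη _)] at h
  rw [eq_neg_of_add_eq_zero_left (ha.pd_du x), wedge, mink_neg_right, mink_sub_right,
    mink_smul_right, mink_smul_right, S.F_null, S.W₁_perp] at h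
  simp at h
  exact h.symm

lemma mink_pd_dv (ha : IsTopPair S a a')
    (hη : ∀ x, ∃ z, wedge n (S.F x) (S.W₁ x) z ≠ 0) (x : Surf) :
    mink n (pd dv S.F x) (a x) = 0 := by
  have h := fderiv_mink S.smooth_F ha.smooth x dv
  simp only [ha.mink_F (hη _)] at h
  rw [eq_neg_of_add_eq_zero_left (ha.pd_dv x), wedge, mink_neg_right, mink_sub_right,
    mink_smul_right, mink_smul_right, S.F_null, S.W₂_perp] at h
  simp at h
  exact h.symm

/-- The norm of a leading coefficient is constant. -/
lemma mink_self_const (ha : IsTopPair S a a')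
    (hη : ∀ x, ∃ z, wedge n (S.F x) (S.W₁ x) z ≠ 0) (x y : Surf) :
    mink n (a x) (a x) = mink n (a y) (a y) := by
  refine eq_of_pd_eq_zero (a := fun x => mink n (a x) (a x)) (ha.smooth.mink ha.smooth)
    (fun z => ?_) (fun z => ?_) x y
  · rw [fderiv_mink ha.smooth ha.smooth, mink_comm (pd du a z),
      eq_neg_of_add_eq_zero_left (ha.pd_du z), wedge]
    simp [mink_sub_left, mink_smul_left, mink_comm (a z), ha.mink_F (hη z),
      ha.mink_W₁ (hη z)]
  · rw [fderiv_mink ha.smooth ha.smooth, mink_comm (pd dv a z),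
      eq_neg_of_add_eq_zero_left (ha.pd_dv z), wedge]
    simp [mink_sub_left, mink_smul_left, mink_comm (a z), ha.mink_F (hη z),
      ha.mink_W₂ (hη z)]

end IsTopPair

/-- Closedness of `η`, evaluated on a fixed vector. -/
lemma exists_eta_closed (S : IsothermicSurface n) (x : Surf) : ∃ D : MV n, ∀ z,
    wedge n (pd du S.F x) (S.W₂ x) z - wedge n (pd dv S.F x) (S.W₁ x) z
      = -wedge n (S.F x) D z := by
  refine ⟨pd du S.W₂ x - pd dv S.W₁ x, fun z => ?_⟩
  have key : ∀ (W : Surf → MV n), ContDiff ℝ (⊤ : ℕ∞) W → ∀ e,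
      fderiv ℝ (fun y => wedge n (S.F y) (W y) z) x e
        = wedge n (pd e S.F x) (W x) z + wedge n (S.F x) (pd e W x) z := by
    intro W hW e
    have hz : ContDiff ℝ (⊤ : ℕ∞) (fun _ : Surf => z) := contDiff_const
    have hF := hasLineDerivAt_of_contDiff S.smooth_F x e
    have hW' := hasLineDerivAt_of_contDiff hW x e
    have h := ((hF.mink (hasDerivAt_const 0 z)).smul hW').sub
      ((hW'.mink (hasDerivAt_const 0 z)).smul hF)
    have hs : ContDiff ℝ (⊤ : ℕ∞) (fun y => wedge n (S.F y) (W y) z) :=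
      ((S.smooth_F.mink hz).smul hW).sub ((hW.mink hz).smul S.smooth_F)
    refine (pd_eq_of_hasDerivAt hs h).trans ?_
    simp only [wedge, pd, zero_smul, add_zero, mink_zero_right]
    module
  have h := S.eta_closed x z
  rw [key _ S.smooth_W₂, key _ S.smooth_W₁] at h
  simp only [wedge, mink_sub_left] at h ⊢
  linear_combination (norm := module) h

/-- The leading coefficient of a conserved quantity vanishes if it is null. -/
lemma IsTopPair.eq_zero_of_null (hη : ∀ x, ∃ z, wedge n (S.F x) (S.W₁ x) z ≠ 0) {w : MV n}
    (hw : mink n w w = 0) (hFw : ∀ x, mink n (S.F x) w = -1)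
    (ha : IsTopPair S a a') (hnull : ∀ x, mink n (a x) (a x) = 0) : a = 0 := by
  set β : Surf → ℝ := fun x => -mink n (a x) w with hβ
  have hβs : ContDiff ℝ (⊤ : ℕ∞) β := (ha.smooth.mink contDiff_const).neg
  have haF : a = fun x => β x • S.F x := funext fun x =>
    eq_smul_of_null_of_perp_null (S.F_null x) hw (hFw x)
      (by rw [mink_comm, ha.mink_F (hη x)]) (hnull x)
  have hpd : ∀ x e, pd e a x = fderiv ℝ β x e • S.F x + β x • pd e S.F x := by
    intro x e
    refine pd_eq_of_hasDerivAt ha.smooth ?_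
    have h := (hasLineDerivAt_of_contDiff hβs x e).smul
      (hasLineDerivAt_of_contDiff S.smooth_F x e)
    rw [haF]
    refine h.congr_deriv ?_
    simp [pd, add_comm]
  have hβ0 : ∀ x, β x = 0 := by
    intro x
    by_contra hne
    obtain ⟨D, hD⟩ := exists_eta_closed S x
    have hu := ha.pd_du x
    have hv := ha.pd_dv x
    rw [hpd, wedge] at hu hv
    have hz := hD (pd du S.F x)
    simp only [wedge, mink_F_pd_F] at hz
    have hvu := mink_comm (pd dv S.F x) (pd du S.F x)
    have hli := S.immersed x
    rw [Fintype.linearIndependent_iff] at hli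
    set l := mink n (S.F x) (a' x)
    set g := mink n (pd du S.F x) (pd du S.F x)
    set h := mink n (pd dv S.F x) (pd du S.F x)
    have hg : g = 0 := by
      have hcomb := hli ![g * (-fderiv ℝ β x dv + mink n (S.W₂ x) (a' x))
          - h * (-fderiv ℝ β x du + mink n (S.W₁ x) (a' x)) - l * mink n D (pd du S.F x),
        h * β x - l * mink n (S.W₂ x) (pd du S.F x), l * mink n (S.W₁ x) (pd du S.F x) - g * β x]
        (by
          simp [Fin.sum_univ_three]
          linear_combination (norm := module) l • hz - g • hv + h • hu) 2
      have hβg : β x * g + l * mink n (S.W₁ x) (pd du S.F x) = 0 := by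
        have := congrArg (fun v => mink n v (pd du S.F x)) hu
        simpa [mink_add_left, mink_sub_left, mink_smul_left, mink_zero_left, mink_F_pd_F]
          using this
      have h2 : β x * g = 0 := by
        simp at hcomb
        linarith
      exact (mul_eq_zero.mp h2).resolve_left hne
    have hFu := eq_smul_of_null_of_perp_null (S.F_null x) hw (hFw x)
      (by rw [mink_comm, mink_F_pd_F]) hg
    have := hli ![mink n (pd du S.F x) w, 1, 0] (by
      simp [Fin.sum_univ_three]
      linear_combination (norm := module) hFu) 1
    simp at this
  rw [haF]
  funext x
  simp [hβ0 x]

end TopCoefficient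

section Codimension

/-- In `ℝ^{4,1}`, the normal bundle of a surface modulo its light line has rank one. -/
lemma exists_null_combination {F Fu Fv w p q : MV 3} (hli : LinearIndependent ℝ ![F, Fu, Fv])
    (hF : mink 3 F F = 0) (hFu : mink 3 F Fu = 0) (hFv : mink 3 F Fv = 0)
    (hFw : mink 3 F w = -1)
    (hpF : mink 3 F p = 0) (hpu : mink 3 Fu p = 0) (hpv : mink 3 Fv p = 0)
    (hqF : mink 3 F q = 0) (hqu : mink 3 Fu q = 0) (hqv : mink 3 Fv q = 0)
    (hp : mink 3 p p ≠ 0) : ∃ c : ℝ, mink 3 (q - c • p) (q - c • p) = 0 := by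
  refine ⟨mink 3 q p / mink 3 p p, ?_⟩
  set z := q - (mink 3 q p / mink 3 p p) • p with hz
  have hzp : mink 3 z p = 0 := by
    rw [hz, mink_sub_left, mink_smul_left, div_mul_cancel₀ _ hp, sub_self]
  have hpz : mink 3 p z = 0 := by rw [mink_comm, hzp]
  have hzF : mink 3 F z = 0 := by rw [hz, mink_sub_right, mink_smul_right, hqF, hpF]; ring
  have hzu : mink 3 Fu z = 0 := by rw [hz, mink_sub_right, mink_smul_right, hqu, hpu]; ring
  have hzv : mink 3 Fv z = 0 := by rw [hz, mink_sub_right, mink_smul_right, hqv, hpv]; ring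
  by_contra hne
  have hli6 : LinearIndependent ℝ ![F, Fu, Fv, w, p, z] := by
    rw [Fintype.linearIndependent_iff] at hli ⊢
    intro g hg
    simp only [Fin.sum_univ_six, Matrix.cons_val] at hg
    have h3 : g 3 = 0 := by
      have := congrArg (mink 3 F) hg
      simpa [mink_add_right, mink_smul_right, mink_zero_right, hF, hFu, hFv, hFw, hpF, hzF]
        using this
    rw [h3, zero_smul, add_zero] at hg
    have h4 : g 4 = 0 := by
      have := congrArg (fun v => mink 3 v p) hg
      simpa [mink_add_left, mink_smul_left, mink_zero_left, hpF, hpu, hpv, hzp, hp] using this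
    have h5 : g 5 = 0 := by
      have := congrArg (fun v => mink 3 v z) hg
      simpa [mink_add_left, mink_smul_left, mink_zero_left, hzF, hzu, hzv, hpz, hne] using this
    have h012 := hli ![g 0, g 1, g 2] (by
      simpa [Fin.sum_univ_three, h4, h5] using hg)
    have h0 : g 0 = 0 := h012 0
    have h1 : g 1 = 0 := h012 1
    have h2 : g 2 = 0 := h012 2
    intro i
    fin_cases i <;> assumption
  have := hli6.fintype_card_le_finrank
  simp at this

variable {S : IsothermicSurface 3}

/-- Up to scale, a surface in `S³` has at most one conserved quantity of minimal degree. -/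
lemma IsConservedSeq.exists_eq_smul (hη : ∀ x, ∃ z, wedge 3 (S.F x) (S.W₁ x) z ≠ 0)
    {w : MV 3} (hw : mink 3 w w = 0) (hFw : ∀ x, mink 3 (S.F x) w = -1) {d : ℕ}
    (hS : ¬ SpecialOfType 3 S d) {a b : ℕ → Surf → MV 3} (ha : IsConservedSeq S a)
    (hb : IsConservedSeq S b) (had : ∀ k, d + 1 < k → a k = 0) (hbd : ∀ k, d + 1 < k → b k = 0)
    (htop : a (d + 1) ≠ 0) : ∃ c : ℝ, ∀ k x, b k x = c • a k x := by
  have hA := ha.isTopPair (had (d + 2) (by omega))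
  have hB := hb.isTopPair (hbd (d + 2) (by omega))
  have hnn : mink 3 (a (d + 1) 0) (a (d + 1) 0) ≠ 0 := fun h =>
    htop (hA.eq_zero_of_null hη hw hFw fun x => by rw [hA.mink_self_const hη x 0, h])
  obtain ⟨c, hc⟩ := exists_null_combination (S.immersed 0) (S.F_null 0) (mink_F_pd_F S 0 du)
    (mink_F_pd_F S 0 dv) (hFw 0) (hA.mink_F (hη 0)) (hA.mink_pd_du hη 0) (hA.mink_pd_dv hη 0)
    (hB.mink_F (hη 0)) (hB.mink_pd_du hη 0) (hB.mink_pd_dv hη 0) hnn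
  have hD := ha.sub_smul hb c
  have hDd : ∀ k, d + 1 < k → (fun x => b k x - c • a k x) = 0 := fun k hk => by
    funext x
    simp [had k hk, hbd k hk]
  have hDT := hD.isTopPair (hDd (d + 2) (by omega))
  have hDtop := hDT.eq_zero_of_null hη hw hFw fun x => by
    rw [hDT.mink_self_const hη x 0, hc]
  have hzero := hD.eq_zero_of_not_specialOfType hS fun k hk => by
    rcases Nat.lt_or_eq_of_le (Nat.succ_le_of_lt hk) with h | h
    · exact hDd k h
    · exact h ▸ hDtop
  exact ⟨c, fun k x => sub_eq_zero.mp (congrFun (congrFun hzero k) x)⟩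

end Codimension

section Christoffel

variable {n : ℕ}

/-- The `⟨v₀,v∞⟩^⊥`-component of `exp(−f^c ∧ v₀) r`. -/
def middlePart (vinf v0 fc r : MV n) : MV n :=
  r + mink n r vinf • v0 + mink n r v0 • (vinf + fc)

/-- A coefficient of `t Γ^c(t)⁻¹ r(t)`, in terms of three consecutive coefficients
`r`, `r₁`, `r₂` of `r(t)`. -/
def christoffelBack (vinf v0 f fc F Fc r r₁ r₂ : MV n) : MV n :=
  -(mink n r v0 • vinf)
    + (middlePart vinf v0 fc r₁ + mink n f (middlePart vinf v0 fc r₁) • vinf)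
    - mink n r₂ Fc • F

lemma hasDerivAt_christoffelBack {vinf v0 : MV n} {f fc F Fc r r₁ r₂ : ℝ → MV n}
    {df dfc dF dFc dr dr₁ dr₂ : MV n} {t : ℝ}
    (hf : HasDerivAt f df t) (hfc : HasDerivAt fc dfc t) (hF : HasDerivAt F dF t)
    (hFc : HasDerivAt Fc dFc t) (hr : HasDerivAt r dr t) (hr₁ : HasDerivAt r₁ dr₁ t)
    (hr₂ : HasDerivAt r₂ dr₂ t) :
    HasDerivAt (fun s => christoffelBack vinf v0 (f s) (fc s) (F s) (Fc s) (r s) (r₁ s) (r₂ s))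
      (-(mink n dr v0 • vinf)
        + ((dr₁ + mink n dr₁ vinf • v0 + (mink n dr₁ v0 • (vinf + fc t) + mink n (r₁ t) v0 • dfc))
          + (mink n df (middlePart vinf v0 (fc t) (r₁ t))
            + mink n (f t) (dr₁ + mink n dr₁ vinf • v0
              + (mink n dr₁ v0 • (vinf + fc t) + mink n (r₁ t) v0 • dfc))) • vinf)
        - ((mink n dr₂ (Fc t) + mink n (r₂ t) dFc) • F t + mink n (r₂ t) (Fc t) • dF)) t := by
  have hv0 := hasDerivAt_const t v0
  have hvinf := hasDerivAt_const t vinf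
  have hm : HasDerivAt (fun s => middlePart vinf v0 (fc s) (r₁ s))
      (dr₁ + mink n dr₁ vinf • v0 + (mink n dr₁ v0 • (vinf + fc t) + mink n (r₁ t) v0 • dfc))
      t := by
    refine ((hr₁.add ((hr₁.mink hvinf).smul hv0)).add
      ((hr₁.mink hv0).smul (hvinf.add hfc))).congr_deriv ?_
    simp only [mink_zero_right, smul_zero, add_zero, zero_add, Pi.add_apply]
    module
  refine (((((hr.mink hv0).smul hvinf).neg).add (hm.add ((hf.mink hm).smul hvinf))).sub
    ((hr₂.mink hFc).smul hF)).congr_deriv ?_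
  simp only [mink_zero_right, smul_zero, add_zero, zero_add]
  module

/-- The pointwise identity behind `Γ^c(t) · (d + tη) = d + tη^c`. -/
lemma christoffelBack_identity {vinf v0 f fc df dfc r₁ r₂ r₃ : MV n}
    (hinf : mink n vinf vinf = 0) (h0 : mink n v0 v0 = 0) (h0inf : mink n v0 vinf = -1)
    (hf0 : mink n f v0 = 0) (hfinf : mink n f vinf = 0)
    (hfc0 : mink n fc v0 = 0) (hfcinf : mink n fc vinf = 0)
    (hdf0 : mink n df v0 = 0) (hdfinf : mink n df vinf = 0)
    (hdfc0 : mink n dfc v0 = 0) (hdfcinf : mink n dfc vinf = 0)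
    {F Fc dF dFc B dr dr₁ dr₂ : MV n}
    (hF : F = v0 + f + (mink n f f / 2) • vinf) (hFc : Fc = vinf + fc + (mink n fc fc / 2) • v0)
    (hdF : dF = df + mink n f df • vinf) (hdFc : dFc = dfc + mink n fc dfc • v0)
    (hB : B = df + mink n fc df • v0)
    (hdr : dr = -wedge n B Fc r₁) (hdr₁ : dr₁ = -wedge n B Fc r₂)
    (hdr₂ : dr₂ = -wedge n B Fc r₃) :
    (-(mink n dr v0 • vinf)
        + ((dr₁ + mink n dr₁ vinf • v0 + (mink n dr₁ v0 • (vinf + fc) + mink n r₁ v0 • dfc))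
          + (mink n df (middlePart vinf v0 fc r₁)
            + mink n f (dr₁ + mink n dr₁ vinf • v0
              + (mink n dr₁ v0 • (vinf + fc) + mink n r₁ v0 • dfc))) • vinf)
        - ((mink n dr₂ Fc + mink n r₂ dFc) • F + mink n r₂ Fc • dF))
      + wedge n (dfc + mink n f dfc • vinf) F
          (christoffelBack vinf v0 f fc F Fc r₁ r₂ r₃) = 0 := by
  have h0inf' : mink n vinf v0 = -1 := by rw [mink_comm, h0inf]
  have hf0' : mink n v0 f = 0 := by rw [mink_comm, hf0]
  have hfinf' : mink n vinf f = 0 := by rw [mink_comm, hfinf]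
  have hfc0' : mink n v0 fc = 0 := by rw [mink_comm, hfc0]
  have hfcinf' : mink n vinf fc = 0 := by rw [mink_comm, hfcinf]
  subst hdr hdr₁ hdr₂ hB hF hFc hdF hdFc
  simp only [christoffelBack, middlePart, wedge, mink_add_left, mink_add_right, mink_smul_left,
    mink_smul_right, mink_sub_left, mink_sub_right, mink_neg_left, mink_neg_right,
    hinf, h0, h0inf, h0inf', hf0, hf0', hfinf, hfinf', hfc0, hfc0', hfcinf, hfcinf',
    hdf0, hdfinf, hdfc0, hdfcinf,
    mink_comm r₁, mink_comm r₂, mink_comm r₃, mink_comm dfc f,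
    mink_comm df fc, mink_comm dfc fc]
  match_scalars <;> ring

/-- The coefficients of `t Γ^c(t)⁻¹ r(t)`. -/
def christoffelSeq (S Sc : IsothermicSurface n) (vinf v0 : MV n) (f fc : Surf → MV n)
    (r : ℕ → Surf → MV n) (k : ℕ) (x : Surf) : MV n :=
  christoffelBack vinf v0 (f x) (fc x) (S.F x) (Sc.F x) (r k x) (shiftSeq r k x)
    (shiftSeq (shiftSeq r) k x)

lemma christoffelBack_zero (vinf v0 f fc F Fc : MV n) :
    christoffelBack vinf v0 f fc F Fc 0 0 0 = 0 := by
  simp [christoffelBack, middlePart, mink_zero_left, mink_zero_right]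

lemma shiftSeq_christoffelSeq (S Sc : IsothermicSurface n) (vinf v0 : MV n)
    (f fc : Surf → MV n) (r : ℕ → Surf → MV n) (k : ℕ) (x : Surf) :
    shiftSeq (christoffelSeq S Sc vinf v0 f fc r) k x
      = christoffelBack vinf v0 (f x) (fc x) (S.F x) (Sc.F x) (shiftSeq r k x)
        (shiftSeq (shiftSeq r) k x) (shiftSeq (shiftSeq (shiftSeq r)) k x) := by
  cases k with
  | zero => simp [shiftSeq, christoffelBack_zero]
  | succ k => rfl

lemma mink_pd_left_eq_zero {a : Surf → MV n} (ha : ContDiff ℝ (⊤ : ℕ∞) a) {w : MV n}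
    (h : ∀ x, mink n (a x) w = 0) (x e : Surf) : mink n (pd e a x) w = 0 := by
  have h1 := fderiv_mink ha (contDiff_const (c := w)) x e
  simp only [h] at h1
  simpa [pd, mink_zero_right] using h1.symm

/-- The differential of a lift `v + g + ½(g,g)w`. -/
lemma pd_lift {F g : Surf → MV n} {v w : MV n} (hg : ContDiff ℝ (⊤ : ℕ∞) g)
    (hFs : ContDiff ℝ (⊤ : ℕ∞) F) (hF : ∀ x, F x = v + g x + (mink n (g x) (g x) / 2) • w)
    (x e : Surf) : pd e F x = pd e g x + mink n (g x) (pd e g x) • w := by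
  refine pd_eq_of_hasDerivAt hFs ?_
  obtain rfl : F = fun x => v + g x + (mink n (g x) (g x) / 2) • w := funext hF
  have h := hasLineDerivAt_of_contDiff hg x e
  refine (((hasDerivAt_const 0 v).add h).add
    (((h.mink h).div_const 2).smul (hasDerivAt_const 0 w))).congr_deriv ?_
  simp only [pd, zero_smul, add_zero, zero_add, smul_zero, mink_comm (fderiv ℝ g x e)]
  module

/-- `t Γ^c(t)⁻¹` pulls conserved quantities of the Christoffel transform back to conserved
quantities of the surface. -/
lemma IsConservedSeq.christoffelSeq {S Sc : IsothermicSurface n} {vinf v0 : MV n}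
    {f fc : Surf → MV n} (hC : IsChristoffelPair n S Sc vinf v0 f fc)
    {r : ℕ → Surf → MV n} (hr : IsConservedSeq Sc r) :
    IsConservedSeq S (christoffelSeq S Sc vinf v0 f fc r) := by
  obtain ⟨hinf, h0, h0inf, hfs, hfcs, hf0, hfinf, hfc0, hfcinf, hF, hFc, hW₁, hW₂, hcW₁, hcW₂⟩ :=
    hC
  have hr1 := hr.shift
  have hr2 := hr1.shift
  have hsm : ∀ k, ContDiff ℝ (⊤ : ℕ∞) (_root_.christoffelSeq S Sc vinf v0 f fc r k) := by
    intro k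
    have hv0 : ContDiff ℝ (⊤ : ℕ∞) (fun _ : Surf => v0) := contDiff_const
    have hvinf : ContDiff ℝ (⊤ : ℕ∞) (fun _ : Surf => vinf) := contDiff_const
    have hm : ContDiff ℝ (⊤ : ℕ∞) (fun x => middlePart vinf v0 (fc x) (shiftSeq r k x)) :=
      ((hr1.smooth k).add (((hr1.smooth k).mink hvinf).smul hv0)).add
        (((hr1.smooth k).mink hv0).smul (hvinf.add hfcs))
    exact (((((hr.smooth k).mink hv0).smul hvinf).neg).add
      (hm.add ((hfs.mink hm).smul hvinf))).sub (((hr2.smooth k).mink Sc.smooth_F).smul S.smooth_F)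
  have key : ∀ (e : Surf) (V : Surf → MV n) (Vc : Surf → MV n),
      (∀ x z, wedge n (S.F x) (V x) z
        = wedge n (pd e fc x + mink n (f x) (pd e fc x) • vinf) (S.F x) z) →
      (∀ x z, wedge n (Sc.F x) (Vc x) z
        = wedge n (pd e f x + mink n (fc x) (pd e f x) • v0) (Sc.F x) z) →
      (∀ a : ℕ → Surf → MV n, IsConservedSeq Sc a → ∀ k x,
        pd e (a k) x + wedge n (Sc.F x) (Vc x) (shiftSeq a k x) = 0) →
      ∀ k x, pd e (_root_.christoffelSeq S Sc vinf v0 f fc r k) x + wedge n (S.F x) (V x)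
        (shiftSeq (_root_.christoffelSeq S Sc vinf v0 f fc r) k x) = 0 := by
    intro e V Vc hV hVc hcons k x
    have hd := hasDerivAt_christoffelBack (vinf := vinf) (v0 := v0)
      (hasLineDerivAt_of_contDiff hfs x e) (hasLineDerivAt_of_contDiff hfcs x e)
      (hasLineDerivAt_of_contDiff S.smooth_F x e) (hasLineDerivAt_of_contDiff Sc.smooth_F x e)
      (hasLineDerivAt_of_contDiff (hr.smooth k) x e)
      (hasLineDerivAt_of_contDiff (hr1.smooth k) x e)
      (hasLineDerivAt_of_contDiff (hr2.smooth k) x e)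
    rw [pd_eq_of_hasDerivAt (hsm k) hd, hV, shiftSeq_christoffelSeq]
    simp only [zero_smul, add_zero]
    refine christoffelBack_identity (B := pd e f x + mink n (fc x) (pd e f x) • v0)
      hinf.2 h0.2 h0inf (hf0 x) (hfinf x) (hfc0 x) (hfcinf x)
      (mink_pd_left_eq_zero hfs hf0 x e) (mink_pd_left_eq_zero hfs hfinf x e)
      (mink_pd_left_eq_zero hfcs hfc0 x e) (mink_pd_left_eq_zero hfcs hfcinf x e)
      (hF x) (hFc x) (pd_lift hfs S.smooth_F hF x e) (pd_lift hfcs Sc.smooth_F hFc x e) rfl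
      ?_ ?_ ?_
    · rw [← hVc]
      exact eq_neg_of_add_eq_zero_left (hcons r hr k x)
    · rw [← hVc]
      exact eq_neg_of_add_eq_zero_left (hcons _ hr1 k x)
    · rw [← hVc]
      exact eq_neg_of_add_eq_zero_left (hcons _ hr2 k x)
  exact ⟨hsm, key du _ _ hW₁ hcW₁ fun a ha => ha.pd_du, key dv _ _ hW₂ hcW₂ fun a ha => ha.pd_dv⟩

/-- A surface with a Christoffel transform has nowhere vanishing `η`. -/
lemma IsChristoffelPair.exists_wedge_ne {S Sc : IsothermicSurface n} {vinf v0 : MV n}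
    {f fc : Surf → MV n} (hC : IsChristoffelPair n S Sc vinf v0 f fc) (x : Surf) :
    ∃ z, wedge n (S.F x) (S.W₁ x) z ≠ 0 := by
  obtain ⟨hinf, h0, h0inf, hfs, hfcs, hf0, hfinf, hfc0, hfcinf, hF, hFc, hW₁, -⟩ := hC
  refine ⟨vinf, fun h => ?_⟩
  have hFinf : mink n (S.F x) vinf = -1 := by
    simp [hF, mink_add_left, mink_smul_left, hinf.2, h0inf, hfinf]
  have hd := mink_pd_left_eq_zero hfcs hfcinf x du
  have hd0 := mink_pd_left_eq_zero hfcs hfc0 x du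
  rw [hW₁, wedge, hFinf, mink_add_left, mink_smul_left, hd, hinf.2] at h
  have hA : pd du fc x + mink n (f x) (pd du fc x) • vinf = 0 := by
    linear_combination (norm := module) h
  have hs : mink n (f x) (pd du fc x) = 0 := by
    have := congrArg (fun v => mink n v v0) hA
    simpa [mink_add_left, mink_smul_left, hd0, mink_zero_left, mink_comm vinf v0, h0inf]
      using this
  rw [hs, zero_smul, add_zero] at hA
  have hFcu := pd_lift hfcs Sc.smooth_F hFc x du
  rw [hA, mink_zero_right, zero_smul, add_zero] at hFcu
  exact (Sc.immersed x).ne_zero 1 hFcu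

/-- `t Γ^c(t)⁻¹` is injective on polynomials of sections. -/
lemma eq_zero_of_christoffelSeq_eq_zero {S Sc : IsothermicSurface n} {vinf v0 : MV n}
    {f fc : Surf → MV n} (hC : IsChristoffelPair n S Sc vinf v0 f fc) {r : ℕ → Surf → MV n}
    (h : ∀ k x, christoffelSeq S Sc vinf v0 f fc r k x = 0) (k : ℕ) (x : Surf) : r k x = 0 := by
  obtain ⟨hinf, h0, h0inf, hfs, hfcs, hf0, hfinf, hfc0, hfcinf, hF, hFc, -⟩ := hC
  have h0inf' : mink n vinf v0 = -1 := by rw [mink_comm, h0inf]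
  have hFinf : mink n (S.F x) vinf = -1 := by
    simp [hF, mink_add_left, mink_smul_left, hinf.2, h0inf, hfinf]
  have hF0 : mink n vinf (S.F x) = -1 := by rw [mink_comm, hFinf]
  have hrFc : ∀ k, mink n (r k x) (Sc.F x) = 0 := by
    intro k
    have := congrArg (fun v => mink n v vinf) (h (k + 2) x)
    simpa [christoffelSeq, christoffelBack, middlePart, shiftSeq, mink_add_left, mink_sub_left,
      mink_neg_left, mink_smul_left, mink_zero_left, hinf.2, h0inf, hfcinf, hFinf] using this
  have hm0 : ∀ s, mink n (middlePart vinf v0 (fc x) s) v0 = 0 := fun s => by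
    simp [middlePart, mink_add_left, mink_smul_left, h0.2, h0inf', hfc0]
  have hminf : ∀ s, mink n (middlePart vinf v0 (fc x) s) vinf = 0 := fun s => by
    simp [middlePart, mink_add_left, mink_smul_left, hinf.2, h0inf, hfcinf]
  have hsFc : ∀ k, mink n (shiftSeq (shiftSeq r) k x) (Sc.F x) = 0 := by
    rintro (_ | _ | k)
    · exact mink_zero_left n _
    · exact mink_zero_left n _
    · exact hrFc k
  have hmF : ∀ s, mink n (middlePart vinf v0 (fc x) s) (S.F x)
      = mink n (f x) (middlePart vinf v0 (fc x) s) := fun s => by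
    rw [hF, mink_add_right, mink_add_right, mink_smul_right, hm0, hminf, mink_comm]
    ring
  have hrv0 : ∀ k, mink n (r k x) v0 = 0 := by
    intro k
    have := congrArg (fun v => mink n v (S.F x)) (h k x)
    simpa [christoffelSeq, christoffelBack, hsFc, mink_add_left, mink_neg_left, mink_smul_left,
      mink_zero_left, hF0, hmF] using this
  have hm := h (k + 1) x
  simp only [christoffelSeq, christoffelBack, hsFc, hrv0, zero_smul, neg_zero, zero_add,
    sub_zero] at hm
  rw [show shiftSeq r (k + 1) x = r k x from rfl] at hm
  have hfm : mink n (f x) (middlePart vinf v0 (fc x) (r k x)) = 0 := by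
    have := congrArg (fun v => mink n v v0) hm
    simpa [mink_add_left, mink_smul_left, mink_zero_left, h0inf', hm0] using this
  rw [hfm, zero_smul, add_zero, middlePart, hrv0, zero_smul, add_zero] at hm
  have hv0Fc : mink n v0 (Sc.F x) = -1 := by
    rw [hFc, mink_add_right, mink_add_right, mink_smul_right, h0.2, h0inf, mink_comm v0, hfc0]
    ring
  have hrinf : mink n (r k x) vinf = 0 := by
    have := congrArg (fun v => mink n v (Sc.F x)) hm
    simpa [mink_add_left, mink_smul_left, mink_zero_left, hrFc, hv0Fc] using this
  simpa [hrinf] using hm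

end Christoffel

lemma pcEval_zero {n d : ℕ} {S : IsothermicSurface n}
    (p : PolyConservedQuantity n S d) (x : Surf) : pcEval p 0 x = p.coeff 0 x := by
  simp [pcEval, Finset.sum_range_succ']

lemma deriv_mink_pcEval_zero {n d : ℕ} {S : IsothermicSurface n}
    (p : PolyConservedQuantity n S d) (x : Surf) :
    deriv (fun t : ℝ => mink n (pcEval p t x) (pcEval p t x)) 0
      = 2 * mink n (p.coeff 0 x) (p.coeff 1 x) := by
  have hE : HasDerivAt (fun t : ℝ => pcEval p t x) (p.coeff 1 x) 0 := by
    have h : HasDerivAt (fun t : ℝ => pcEval p t x)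
        (∑ k ∈ Finset.range (d + 1), ((k : ℝ) * 0 ^ (k - 1)) • p.coeff k x) 0 :=
      HasDerivAt.fun_sum fun k _ => (hasDerivAt_pow k (0 : ℝ)).smul_const (p.coeff k x)
    refine h.congr_deriv ?_
    rw [Finset.sum_eq_single 1]
    · simp
    · rintro (_ | _ | k) _ hk
      · simp
      · exact absurd rfl hk
      · simp
    · intro h1
      rw [p.coeff_eq_zero 1 (by simpa using h1)]
      simp
  rw [(hE.mink hE).deriv, pcEval_zero, mink_comm (p.coeff 1 x)]
  ring

/-- Proposition: in `S³`, if `(Λ,η)` is special isothermic of type `d` but not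
of type `d−1` and its Christoffel transform is special isothermic of type
`d−1`, then `0` is a repeated root of `(p(t),p(t))` and `p(0) ∈ ⟨v∞⟩`. -/
theorem christoffel_transform_type_pred_necessary (d : ℕ) (hd : 1 ≤ d)
    (S Sc : IsothermicSurface 3) (vinf v0 : MV 3) (f fc : Surf → MV 3)
    (hC : IsChristoffelPair 3 S Sc vinf v0 f fc)
    (p : PolyConservedQuantity 3 S d)
    (hnot : ¬ SpecialOfType 3 S (d - 1))
    (hSc : SpecialOfType 3 Sc (d - 1)) :
    IsRepeatedRootAt p 0 ∧ ∀ x, p.coeff 0 x ∈ Submodule.span ℝ {vinf} := by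
  obtain ⟨r⟩ := hSc
  obtain ⟨e, rfl⟩ : ∃ e, d = e + 1 := ⟨d - 1, by omega⟩
  rw [Nat.add_sub_cancel] at hnot r
  have hη := hC.exists_wedge_ne
  have hr := r.isConservedSeq
  have hq := hr.christoffelSeq hC
  have hC' := hC
  obtain ⟨hinf, h0, h0inf, -, -, -, hfinf, -, hfcinf, hF, -⟩ := hC'
  have hFw : ∀ x, mink 3 (S.F x) vinf = -1 := fun x => by
    simp [hF, mink_add_left, mink_smul_left, hinf.2, h0inf, hfinf]
  set q := christoffelSeq S Sc vinf v0 f fc r.coeff with hqdef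
  have hq2 : ∀ k, e + 2 < k → q k = 0 := by
    intro k hk
    obtain ⟨j, rfl⟩ : ∃ j, k = j + 2 := ⟨k - 2, by omega⟩
    funext x
    simp only [hqdef, christoffelSeq, shiftSeq, r.coeff_eq_zero (j + 2) (by omega),
      r.coeff_eq_zero (j + 1) (by omega), r.coeff_eq_zero j (by omega), Pi.zero_apply,
      christoffelBack_zero]
  have hqtop : q (e + 2) = 0 := by
    refine (hq.isTopPair (hq2 (e + 3) (by omega))).eq_zero_of_null hη hinf.2 hFw fun x => ?_
    simp [hqdef, christoffelSeq, shiftSeq, r.coeff_eq_zero (e + 2) (by omega),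
      r.coeff_eq_zero (e + 1) (by omega), christoffelBack, middlePart, mink_zero_left,
      mink_zero_right, mink_neg_left, mink_neg_right, mink_smul_left, mink_smul_right, S.F_null]
  have hq1 : ∀ k, e + 1 < k → q k = 0 := fun k hk => by
    rcases Nat.lt_or_eq_of_le (Nat.succ_le_of_lt hk) with h | h
    · exact hq2 k h
    · exact h ▸ hqtop
  obtain ⟨c, hc⟩ := p.isConservedSeq.exists_eq_smul hη hinf.2 hFw hnot hq p.coeff_eq_zero hq1
    p.top_ne
  have hc0 : c ≠ 0 := by
    rintro rfl
    refine r.top_ne (funext fun x => eq_zero_of_christoffelSeq_eq_zero hC (fun k y => ?_) e x)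
    rw [← zero_smul ℝ (p.coeff k y)]
    exact hc k y
  have hp : ∀ k x, p.coeff k x = c⁻¹ • q k x := fun k x => by
    rw [hc, smul_smul, inv_mul_cancel₀ hc0, one_smul]
  have hq0 : ∀ x, q 0 x = -mink 3 (r.coeff 0 x) v0 • vinf := fun x => by
    simp [hqdef, christoffelSeq, christoffelBack, shiftSeq, middlePart, mink_zero_left,
      mink_zero_right]
  have hqinf : ∀ x, mink 3 vinf (q 1 x) = 0 := fun x => by
    rw [mink_comm]
    simp [hqdef, christoffelSeq, christoffelBack, shiftSeq, middlePart, mink_zero_left,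
      mink_add_left, mink_neg_left, mink_smul_left, hinf.2, h0inf, hfcinf]
  refine ⟨fun x => ⟨?_, ?_⟩, fun x => ?_⟩
  · rw [pcEval_zero, hp, hq0]
    simp [mink_smul_left, mink_smul_right, mink_neg_left, mink_neg_right, hinf.2]
  · rw [deriv_mink_pcEval_zero, hp, hp, hq0]
    simp [mink_smul_left, mink_smul_right, mink_neg_left, hqinf]
  · rw [hp, hq0]
    exact Submodule.smul_mem _ _ (Submodule.smul_mem _ _ (Submodule.mem_span_singleton_self _))
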